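/- Let k ≥ 2 and r ≥ 1. Every n-vertex k-uniform hypergraph with more than ((r + ⌊(r−1)/k⌋)/2)·C(n, k−1) edges contains a tight path of length r (i.e., a k-uniform (k−1)-path with r edges). In particular, for k ≥ 3 and r = k+1... (the paper's use: ex(n, P_k^{k−1}) ≤ ((k+1)/2)·C(n,k−2) for (k−1)-uniform paths of length k). -/

import Mathlib

open Finset in
/-- If `f x < g y` whenever `x` precedes `y`, then the sum of `f` exceeds that of `g` by at most
an upper bound of `f`, minus the number of terms. -/
theorem sum_add_card_le_of_key {α β : Type*} [LinearOrder β] [DecidableEq α]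
    (key : α → β) (f g : α → ℕ) (A : Finset α) (B : ℕ) (hinj : Set.InjOn key A)
    (hg : ∀ x ∈ A, 1 ≤ g x) (hB : ∀ x ∈ A, f x ≤ B)
    (hfg : ∀ x ∈ A, ∀ y ∈ A, key x < key y → f x + 1 ≤ g y) :
    ∑ x ∈ A, f x + #A ≤ ∑ x ∈ A, g x + B := by
  induction A using Finset.induction_on_max_value key generalizing B with
  | empty => simp
  | insert a s ha hmax ih =>
    have hlt : ∀ x ∈ s, key x < key a := fun x hx =>
      lt_of_le_of_ne (hmax x hx) fun h => ha <| by
        have := hinj (by simp [hx]) (by simp) h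
        exact this ▸ hx
    have h1 := ih (g a - 1) (hinj.mono (by simp))
      (fun x hx => hg x (mem_insert_of_mem hx))
      (fun x hx => by
        have := hfg x (mem_insert_of_mem hx) a (mem_insert_self _ _) (hlt x hx)
        omega)
      (fun x hx y hy => hfg x (mem_insert_of_mem hx) y (mem_insert_of_mem hy))
    have h2 := hg a (mem_insert_self _ _)
    have h3 := hB a (mem_insert_self _ _)
    rw [sum_insert ha, sum_insert ha, card_insert_of_notMem ha]
    omega

namespace TightPath

open Finset

variable {V : Type*} {k : ℕ}

/-- Positions are grouped in consecutive pairs, the last one being alone if `k` is odd. -/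
def partner (j : Fin k) : Fin k :=
  ⟨if j.1 % 2 = 1 then j.1 - 1 else if j.1 + 1 < k then j.1 + 1 else j.1, by
    have := j.2
    split_ifs <;> omega⟩

/-- The pair a position belongs to. -/
def color (j : Fin k) : Fin ((k + 1) / 2) := ⟨j.1 / 2, by have := j.2; omega⟩

/-- The rank of `x` as a candidate for position `j`: the first member of a pair moves clockwise
and the second one anticlockwise, towards each other. -/
def key (p : V → ℤ) (n : ℤ) (w : Fin k → V) (j : Fin k) (x : V) : ℤ :=
  if partner j = j then p x
  else if j.1 % 2 = 0 then (if p (w (partner j)) ≤ p x then p x else p x + n)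
  else (if p x ≤ p (w (partner j)) then -p x else n - p x)

/-- `x` is still available for the position `j`. -/
def Available (p : V → ℤ) (n : ℤ) (w : Fin k → V) (j : Fin k) (x : V) : Prop :=
  key p n w j (w j) < key p n w j x

theorem color_partner (j : Fin k) : color (partner j) = color j := by
  have := j.2
  simp only [color, partner, Fin.mk.injEq]
  split_ifs <;> omega

theorem eq_or_eq_partner {i j : Fin k} (h : color i = color j) : i = j ∨ i = partner j := by
  have := j.2
  have := i.2
  simp only [color, Fin.mk.injEq] at h
  simp only [partner, Fin.ext_iff]
  split_ifs <;> omega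

theorem partner_partner (j : Fin k) : partner (partner j) = j := by
  have := j.2
  simp only [partner, Fin.ext_iff]
  split_ifs <;> omega

theorem partner_parity {j : Fin k} (h : partner j ≠ j) :
    (partner j).1 % 2 = 0 ↔ ¬ j.1 % 2 = 0 := by
  have := j.2
  simp only [partner, ne_eq, Fin.ext_iff] at h ⊢
  split_ifs at h ⊢ <;> omega

theorem key_congr (p : V → ℤ) (n : ℤ) {w w' : Fin k → V} {j : Fin k}
    (h : partner j ≠ j → w (partner j) = w' (partner j)) (x : V) :
    key p n w j x = key p n w' j x := by
  unfold key
  by_cases hj : partner j = j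
  · simp [hj]
  · simp [hj, h hj]

theorem key_update (p : V → ℤ) (n : ℤ) (w : Fin k → V) (j : Fin k) (x y : V) :
    key p n (Function.update w j y) j x = key p n w j x :=
  key_congr p n (fun h => by simp [Function.update_of_ne h]) x

section

variable {p : V → ℤ} {n : ℤ} (hp : Function.Injective p) (h0 : ∀ x, 0 ≤ p x) (hn : ∀ x, p x < n)
include hp h0 hn

theorem key_injective (w : Fin k → V) (j : Fin k) : Function.Injective (key p n w j) := by
  intro x y h
  apply hp
  have := h0 x
  have := h0 y
  have := hn x
  have := hn y
  unfold key at h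
  split_ifs at h <;> omega

theorem available_partner {w : Fin k → V} (hw : Function.Injective w) (j : Fin k) (x : V) :
    Available p n w (partner j) x ↔ Available p n w j x := by
  by_cases hj : partner j = j
  · rw [hj]
  have hpar := partner_parity hj
  have hne : p (w j) ≠ p (w (partner j)) := fun h => hj (hw (hp h)).symm
  have := h0 x
  have := h0 (w j)
  have := h0 (w (partner j))
  have := hn x
  have := hn (w j)
  have := hn (w (partner j))
  unfold Available key
  rw [partner_partner, if_neg hj, if_neg hj, if_neg (Ne.symm hj), if_neg (Ne.symm hj)]
  simp only [hpar]
  split_ifs <;> omega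

theorem available_congr_color {w : Fin k → V} (hw : Function.Injective w) {i j : Fin k}
    (hij : color i = color j) (x : V) : Available p n w i x ↔ Available p n w j x := by
  rcases eq_or_eq_partner hij with rfl | rfl
  · rfl
  · exact available_partner hp h0 hn hw j x

theorem Available.of_update {w : Fin k → V} {t : Fin k} {y : V}
    (hw : Function.Injective w) (hw' : Function.Injective (Function.update w t y))
    (hy : Available p n w t y) {j : Fin k} {x : V}
    (hx : Available p n (Function.update w t y) j x) : Available p n w j x := by
  by_cases hjt : color j = color t
  · rw [available_congr_color hp h0 hn hw' hjt] at hx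
    rw [available_congr_color hp h0 hn hw hjt]
    unfold Available at hx hy ⊢
    rw [key_update, key_update, Function.update_self] at hx
    exact hy.trans hx
  · have h1 : j ≠ t := fun h => hjt (h ▸ rfl)
    have h2 : partner j ≠ t := fun h => hjt (by rw [← h, color_partner])
    unfold Available at hx ⊢
    rwa [Function.update_of_ne h1,
      key_congr p n (fun _ => Function.update_of_ne h2 _ _),
      key_congr p n (fun _ => Function.update_of_ne h2 _ _)] at hx

end

section

variable [NeZero k]

theorem ofNat_add_ne (t : ℕ) {i : ℕ} (h0 : 0 < i) (hi : i < k) :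
    Fin.ofNat k (t + i) ≠ Fin.ofNat k t := by
  intro h
  have h1 : t + i ≡ t + 0 [MOD k] := congrArg Fin.val h
  have h2 := Nat.ModEq.add_left_cancel' t h1
  rw [Nat.ModEq, Nat.mod_eq_of_lt hi, Nat.zero_mod] at h2
  omega

theorem ofNat_add_injOn (t : ℕ) : Set.InjOn (fun i => Fin.ofNat k (t + i)) (Set.Iio k) := by
  intro i hi j hj h
  have h1 : t + i ≡ t + j [MOD k] := congrArg Fin.val h
  have h2 := Nat.ModEq.add_left_cancel' t h1
  rwa [Nat.ModEq, Nat.mod_eq_of_lt hi, Nat.mod_eq_of_lt hj] at h2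

theorem ofNat_add_self (t : ℕ) : Fin.ofNat k (t + k) = Fin.ofNat k t :=
  Fin.ext (Nat.add_mod_right t k)

theorem image_ofNat_add (t : ℕ) : (range k).image (fun i => Fin.ofNat k (t + i)) = univ := by
  apply eq_univ_of_card
  rw [card_image_of_injOn]
  · simp
  · rw [coe_range]
    exact ofNat_add_injOn t

theorem image_comp_ofNat_add [DecidableEq V] (w : Fin k → V) (t : ℕ) :
    (range k).image (fun i => w (Fin.ofNat k (t + i))) = univ.image w := by
  rw [← image_ofNat_add t, image_image]
  rfl

variable [DecidableEq V]

/-- `w` is an ordering of an edge whose vertices have the colours prescribed by `color`. -/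
def IsConfig (E : Finset (Finset V)) (χ : V → Fin ((k + 1) / 2)) (w : Fin k → V) : Prop :=
  Function.Injective w ∧ univ.image w ∈ E ∧ ∀ j, χ (w j) = color j

/-- There is a tight path with `l + 1` edges ending in `w`, whose oldest vertex is at position `t`,
and none of its vertices is available any more. -/
def Reach (E : Finset (Finset V)) (χ : V → Fin ((k + 1) / 2)) (p : V → ℤ) (n : ℤ)
    (l t : ℕ) (w : Fin k → V) : Prop :=
  ∃ v : ℕ → V, Set.InjOn v (Set.Iio (k + l)) ∧
    (∀ i < l + 1, (range k).image (fun j => v (i + j)) ∈ E) ∧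
    (∀ j < k, v (l + j) = w (Fin.ofNat k (t + j))) ∧
    ∀ i < k + l, ∀ j, color j = χ (v i) → ¬ Available p n w j (v i)

variable {E : Finset (Finset V)} {χ : V → Fin ((k + 1) / 2)} {p : V → ℤ} {n : ℤ}

theorem reach_add_self (l t : ℕ) (w : Fin k → V) :
    Reach E χ p n l (t + k) w ↔ Reach E χ p n l t w := by
  have (j : ℕ) : Fin.ofNat k (t + k + j) = Fin.ofNat k (t + j) := by
    rw [add_right_comm, ofNat_add_self]
  simp only [Reach, this]

section

variable (hp : Function.Injective p) (h0 : ∀ x, 0 ≤ p x) (hn : ∀ x, p x < n)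
include hp h0 hn

theorem reach_zero {w : Fin k → V} (hw : IsConfig E χ w) (t : ℕ) : Reach E χ p n 0 t w := by
  refine ⟨fun i => w (Fin.ofNat k (t + i)), ?_, ?_, ?_, ?_⟩
  · exact fun i hi j hj h => ofNat_add_injOn t hi hj (hw.1 h)
  · intro i hi
    obtain rfl : i = 0 := by omega
    simp only [zero_add]
    rw [image_comp_ofNat_add]
    exact hw.2.1
  · simp
  · intro i _ j hj
    rw [hw.2.2] at hj
    rw [available_congr_color hp h0 hn hw.1 hj]
    exact lt_irrefl _

theorem Reach.succ {l t : ℕ} {w : Fin k → V} {y : V} (hr : Reach E χ p n l t w)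
    (hw : IsConfig E χ w) (hw' : IsConfig E χ (Function.update w (Fin.ofNat k t) y))
    (hy : Available p n w (Fin.ofNat k t) y) :
    Reach E χ p n (l + 1) (t + 1) (Function.update w (Fin.ofNat k t) y) := by
  obtain ⟨v, hv, hE, hlast, hav⟩ := hr
  have hχ : χ y = color (Fin.ofNat k t) := by simpa using hw'.2.2 (Fin.ofNat k t)
  have hnew : ∀ i < k + l, v i ≠ y := by
    rintro i hi rfl
    exact hav i hi _ hχ.symm hy
  have hk : 0 < k := Nat.pos_of_neZero k
  have hlast' : ∀ j < k, (if l + 1 + j < k + l then v (l + 1 + j) else y) =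
      Function.update w (Fin.ofNat k t) y (Fin.ofNat k (t + 1 + j)) := by
    intro j hj
    split_ifs with h
    · rw [add_assoc t, Function.update_of_ne (ofNat_add_ne t (by omega) (by omega)),
        ← hlast _ (by omega), add_assoc l]
    · rw [show t + 1 + j = t + k by omega, ofNat_add_self, Function.update_self]
  refine ⟨fun i => if i < k + l then v i else y, ?_, ?_, hlast', ?_⟩
  · intro i hi j hj h
    simp only [Set.mem_Iio] at hi hj
    dsimp only at h
    split_ifs at h with h1 h2 h2
    · exact hv h1 h2 h
    · exact (hnew i h1 h).elim
    · exact (hnew j h2 h.symm).elim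
    · omega
  · intro i hi
    by_cases h : i < l + 1
    · convert hE i h using 1
      refine image_congr fun j hj => ?_
      simp only [coe_range, Set.mem_Iio] at hj
      exact if_pos (by omega)
    · obtain rfl : i = l + 1 := by omega
      rw [image_congr (g := fun j => Function.update w (Fin.ofNat k t) y
        (Fin.ofNat k (t + 1 + j))) (fun j hj => hlast' j (by simpa using hj)),
        image_comp_ofNat_add]
      exact hw'.2.1
  · intro i hi j hj
    dsimp only at hj ⊢
    split_ifs at hj ⊢ with h
    · exact fun hx => hav i h j hj (hy.of_update hp h0 hn hw.1 hw'.1 hx)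
    · rw [hχ] at hj
      rw [available_congr_color hp h0 hn hw'.1 hj, Available, Function.update_self]
      exact lt_irrefl _

end

theorem card_config_le [Fintype V] (hp : Function.Injective p) (h0 : ∀ x, 0 ≤ p x)
    (hn : ∀ x, p x < n) {r : ℕ} (hr : 1 ≤ r)
    (hno : ¬ ∃ v : ℕ → V, Set.InjOn v (Set.Iio (k + r - 1)) ∧
      ∀ i < r, ((Finset.range k).image (fun j => v (i + j))) ∈ E)
    (χ : V → Fin ((k + 1) / 2)) :
    k * Nat.card {w : Fin k → V // IsConfig E χ w} ≤
      (r - 1) * ∑ t ∈ range k, Nat.card {u : {j : Fin k // j ≠ Fin.ofNat k t} ↪ V //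
        ∀ j, χ (u j) = color j.1} := by
  classical
  have hbound : ∀ l t w, Reach E χ p n l t w → l + 1 ≤ r - 1 := by
    rintro l t w ⟨v, hv, hE, -⟩
    by_contra hl
    exact hno ⟨v, hv.mono (Set.Iio_subset_Iio (by omega)), fun i hi => hE i (by omega)⟩
  obtain ⟨f, hf⟩ : ∃ f : ℕ → (Fin k → V) → ℕ,
      ∀ t w, f t w = Nat.findGreatest (Reach E χ p n · t w) r + 1 := ⟨_, fun _ _ => rfl⟩
  set C : Finset (Fin k → V) := univ.filter (IsConfig E χ) with hC
  have hreach : ∀ t, ∀ w ∈ C, Reach E χ p n (f t w - 1) t w := by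
    intro t w hw
    have := Nat.findGreatest_spec (P := (Reach E χ p n · t w)) (Nat.zero_le r)
      (reach_zero hp h0 hn (by simpa [hC] using hw) t)
    rwa [hf, Nat.add_sub_cancel]
  have hle : ∀ l t w, Reach E χ p n l t w → l + 1 ≤ f t w := by
    intro l t w h
    have h1 := hbound l t w h
    have := Nat.le_findGreatest (P := (Reach E χ p n · t w)) (n := r) (by omega) h
    rw [hf]
    omega
  have hstep : ∀ t, ∑ w ∈ C, f t w + #C ≤ ∑ w ∈ C, f (t + 1) w +
      (r - 1) * Nat.card {u : {j : Fin k // j ≠ Fin.ofNat k t} ↪ V //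
        ∀ j, χ (u j) = color j.1} := by
    intro t
    set π : (Fin k → V) → ({j : Fin k // j ≠ Fin.ofNat k t} → V) := fun w j => w j
    set T : Finset ({j : Fin k // j ≠ Fin.ofNat k t} → V) := C.image π
    have hmaps : ∀ w ∈ C, π w ∈ T := fun w hw => mem_image_of_mem _ hw
    have hTcard : #T ≤ Nat.card {u : {j : Fin k // j ≠ Fin.ofNat k t} ↪ V //
        ∀ j, χ (u j) = color j.1} := by
      rw [← Nat.card_eq_finsetCard]
      have key : ∀ u : T, Function.Injective u.1 ∧ ∀ j, χ (u.1 j) = color j.1 := by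
        rintro ⟨u, hu⟩
        obtain ⟨w, hw, rfl⟩ := mem_image.1 hu
        have hw' : IsConfig E χ w := by simpa [hC] using hw
        exact ⟨fun i j h => Subtype.ext (hw'.1 h), fun j => hw'.2.2 j⟩
      refine Nat.card_le_card_of_injective (fun u : T => ⟨⟨u.1, (key u).1⟩, (key u).2⟩) ?_
      intro u u' h
      exact Subtype.ext (congrArg (fun x => (x.1 : {j : Fin k // j ≠ Fin.ofNat k t} → V)) h)
    have hfib : ∀ u ∈ T, ∑ w ∈ C with π w = u, f t w + #(C.filter (π · = u)) ≤
        ∑ w ∈ C with π w = u, f (t + 1) w + (r - 1) := by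
      intro u _
      have hup : ∀ w ∈ C.filter (π · = u), ∀ w' ∈ C.filter (π · = u),
          w' = Function.update w (Fin.ofNat k t) (w' (Fin.ofNat k t)) := by
        intro w hw w' hw'
        have h := (mem_filter.1 hw').2.trans (mem_filter.1 hw).2.symm
        refine Function.eq_update_iff.2 ⟨rfl, fun j hj => congrFun h ⟨j, hj⟩⟩
      have hkey : ∀ w ∈ C.filter (π · = u), ∀ w' ∈ C.filter (π · = u), ∀ x,
          key p n w' (Fin.ofNat k t) x = key p n w (Fin.ofNat k t) x := by
        intro w hw w' hw' x
        rw [hup w hw w' hw', key_update]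
      apply sum_add_card_le_of_key (fun w => key p n w (Fin.ofNat k t) (w (Fin.ofNat k t)))
      · intro w hw w' hw' h
        dsimp only at h
        rw [hkey w hw w' hw'] at h
        have := key_injective hp h0 hn _ _ h
        rw [hup w hw w' hw', ← this, Function.update_eq_self]
      · intro w _
        simp only [hf]
        omega
      · intro w hw
        have := hbound _ _ _ (hreach t w (mem_filter.1 hw).1)
        omega
      · intro w hw w' hw' h
        rw [hkey w hw w' hw'] at h
        have hup' := hup w hw w' hw'
        have hc : IsConfig E χ w := by simpa [hC] using (mem_filter.1 hw).1
        have hc' : IsConfig E χ w' := by simpa [hC] using (mem_filter.1 hw').1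
        have := (hreach t w (mem_filter.1 hw).1).succ hp h0 hn hc (hup' ▸ hc') h
        rw [← hup'] at this
        have := hle _ _ _ this
        omega
    calc ∑ w ∈ C, f t w + #C
        = ∑ u ∈ T, (∑ w ∈ C with π w = u, f t w + #(C.filter (π · = u))) := by
          rw [sum_add_distrib, sum_fiberwise_of_maps_to hmaps,
            card_eq_sum_card_fiberwise hmaps]
      _ ≤ ∑ u ∈ T, (∑ w ∈ C with π w = u, f (t + 1) w + (r - 1)) := sum_le_sum hfib
      _ = ∑ w ∈ C, f (t + 1) w + (r - 1) * #T := by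
          rw [sum_add_distrib, sum_fiberwise_of_maps_to hmaps, sum_const, smul_eq_mul, mul_comm]
      _ ≤ _ := by gcongr
  have hper : f k = f 0 := by
    funext w
    simp only [hf]
    congr 2
    funext l
    simpa using reach_add_self (E := E) (χ := χ) (p := p) (n := n) l 0 w
  have htel : ∑ t ∈ range k, ∑ w ∈ C, f (t + 1) w = ∑ t ∈ range k, ∑ w ∈ C, f t w := by
    have h1 := sum_range_succ (fun t => ∑ w ∈ C, f t w) k
    have h2 := sum_range_succ' (fun t => ∑ w ∈ C, f t w) k
    rw [hper] at h1
    omega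
  have htot := sum_le_sum fun t (_ : t ∈ range k) => hstep t
  simp only [sum_add_distrib, htel, ← mul_sum, sum_const, card_range, smul_eq_mul] at htot
  have hcard : Nat.card {w : Fin k → V // IsConfig E χ w} = #C := by
    rw [Nat.card_eq_fintype_card, Fintype.card_subtype]
  rw [hcard]
  omega

end

theorem card_coloring {ι V D : Type*} [Fintype ι] [Fintype V] [DecidableEq V] [Fintype D]
    (u : ι ↪ V) (c : ι → D) :
    Nat.card {χ : V → D // ∀ j, χ (u j) = c j} =
      Fintype.card D ^ (Fintype.card V - Fintype.card ι) := by
  classical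
  have e : {χ : V → D // ∀ j, χ (u j) = c j} ≃ ({x : V // x ∉ Set.range u} → D) :=
    { toFun := fun χ x => χ.1 x
      invFun := fun g => ⟨fun x => if h : x ∈ Set.range u then c h.choose else g ⟨x, h⟩, by
        intro j
        have h : u j ∈ Set.range u := ⟨j, rfl⟩
        exact (dif_pos h).trans (congrArg c (u.injective h.choose_spec))⟩
      left_inv := by
        rintro ⟨χ, hχ⟩
        ext x
        dsimp only
        split_ifs with h
        · rw [← hχ, h.choose_spec]
        · rfl
      right_inv := by
        intro g
        ext ⟨x, hx⟩
        exact dif_neg hx }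
  rw [Nat.card_congr e, Nat.card_eq_fintype_card, Fintype.card_fun, Fintype.card_subtype_compl]
  congr 2
  exact Set.card_range_of_injective u.injective

theorem sum_card_coloring {ι V D : Type*} [Fintype ι] [Fintype V] [DecidableEq V] [Fintype D]
    [DecidableEq D] (c : ι → D) (P : (ι ↪ V) → Prop) :
    ∑ χ : V → D, Nat.card {u : ι ↪ V // P u ∧ ∀ j, χ (u j) = c j} =
      Nat.card {u : ι ↪ V // P u} * Fintype.card D ^ (Fintype.card V - Fintype.card ι) := by
  classical
  simp only [Nat.card_eq_fintype_card, Fintype.card_subtype, ← filter_filter]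
  simp only [card_filter (fun u : ι ↪ V => ∀ j, _ = c j)]
  rw [sum_comm, ← smul_eq_mul, ← sum_const]
  refine sum_congr rfl fun u _ => ?_
  rw [← card_coloring u c, Nat.card_eq_fintype_card, Fintype.card_subtype, card_filter]

theorem card_orderings [Fintype V] [DecidableEq V] (E : Finset (Finset V))
    (hE : ∀ e ∈ E, #e = k) :
    #E * k.factorial ≤ Nat.card {u : Fin k ↪ V // univ.image u ∈ E} := by
  classical
  rw [Nat.card_eq_fintype_card, Fintype.card_subtype,
    card_eq_sum_card_fiberwise (f := fun u : Fin k ↪ V => univ.image u) (t := E)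
      (fun u hu => by simpa using hu), ← smul_eq_mul, ← sum_const]
  refine sum_le_sum fun e he => ?_
  have h1 : Fintype.card (Fin k ↪ e) = k.factorial := by
    rw [Fintype.card_embedding_eq, Fintype.card_coe, Fintype.card_fin, hE e he,
      Nat.descFactorial_self]
  rw [← h1, ← card_univ]
  refine card_le_card_of_injOn (fun g => g.trans (Function.Embedding.subtype _)) ?_ ?_
  · intro g _
    have : univ.image (fun i => (g i : V)) = e := by
      apply eq_of_subset_of_card_le
      · intro x hx
        obtain ⟨i, -, rfl⟩ := mem_image.1 hx
        exact (g i).2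
      · rw [card_image_of_injective _ (fun i j h => g.injective (Subtype.ext h)), hE e he]
        simp
    have h2 : univ.image (g.trans (Function.Embedding.subtype (· ∈ e))) = e := this
    simp [h2, he]
  · intro g _ g' _ h
    ext i
    exact DFunLike.congr_fun h i

/-- The bound `|E| ≤ (r - 1) ⌈k / 2⌉ / k * C(|V|, k - 1)`. -/
theorem mul_card_le [Fintype V] [DecidableEq V] (hk : 1 ≤ k) {r : ℕ} (hr : 1 ≤ r)
    (E : Finset (Finset V)) (hE : ∀ e ∈ E, #e = k)
    (hno : ¬ ∃ v : ℕ → V, Set.InjOn v (Set.Iio (k + r - 1)) ∧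
      ∀ i < r, ((Finset.range k).image (fun j => v (i + j))) ∈ E) :
    k * #E ≤ (r - 1) * ((k + 1) / 2) * (Fintype.card V).choose (k - 1) := by
  classical
  rcases E.eq_empty_or_nonempty with rfl | ⟨e, he⟩
  · simp
  have hkn : k ≤ Fintype.card V := hE e he ▸ card_le_univ e
  have : NeZero k := ⟨by omega⟩
  set N := Fintype.card V
  set m := (k + 1) / 2
  have hm0 : 0 < m := by omega
  let q := Fintype.equivFin V
  have hχ : ∀ χ : V → Fin m, _ := fun χ =>
    card_config_le (E := E) (p := fun x => ((q x : ℕ) : ℤ)) (n := (N : ℤ))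
      (fun x y h => q.injective (Fin.ext (Nat.cast_injective h)))
      (fun x => by positivity) (fun x => by exact_mod_cast (q x).2) hr hno χ
  have hsum := sum_le_sum fun χ (_ : χ ∈ (univ : Finset (V → Fin m))) => hχ χ
  rw [← mul_sum, ← mul_sum, sum_comm] at hsum
  have hL : ∀ χ : V → Fin m, Nat.card {w : Fin k → V // IsConfig E χ w} =
      Nat.card {u : Fin k ↪ V // univ.image u ∈ E ∧ ∀ j, χ (u j) = color j} := fun χ =>
    Nat.card_congr
      { toFun := fun w => ⟨⟨w.1, w.2.1⟩, w.2.2⟩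
        invFun := fun u => ⟨u.1, u.1.injective, u.2⟩
        left_inv := fun _ => rfl
        right_inv := fun _ => rfl }
  have hR : ∀ t ∈ range k, ∑ χ : V → Fin m,
      Nat.card {u : {j : Fin k // j ≠ Fin.ofNat k t} ↪ V // ∀ j, χ (u j) = color j.1} =
      ((k - 1).factorial * N.choose (k - 1)) * m ^ (N - (k - 1)) := by
    intro t _
    have h := sum_card_coloring (V := V) (fun j : {j : Fin k // j ≠ Fin.ofNat k t} => color j.1)
      (fun _ => True)
    have hc : Fintype.card {j : Fin k // j ≠ Fin.ofNat k t} = k - 1 := by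
      simp
    have hu : Nat.card {u : {j : Fin k // j ≠ Fin.ofNat k t} ↪ V // True} =
        (k - 1).factorial * N.choose (k - 1) := by
      rw [Nat.card_congr (Equiv.subtypeUnivEquiv fun _ => trivial), Nat.card_eq_fintype_card,
        Fintype.card_embedding_eq, hc, Nat.descFactorial_eq_factorial_mul_choose]
    simp only [true_and] at h
    rw [hu, hc, Fintype.card_fin] at h
    exact h
  rw [sum_congr rfl hR, sum_congr rfl fun χ _ => hL χ, sum_card_coloring, sum_const, card_range,
    smul_eq_mul, Fintype.card_fin, Fintype.card_fin] at hsum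
  have hord := card_orderings E hE
  have hfac : k.factorial = k * (k - 1).factorial := (Nat.mul_factorial_pred (by omega)).symm
  have hpow : m ^ (N - (k - 1)) = m * m ^ (N - k) := by
    rw [← pow_succ']
    congr 1
    omega
  rw [hpow] at hsum
  have hpos : 0 < k * (k - 1).factorial * m ^ (N - k) := by positivity
  refine Nat.le_of_mul_le_mul_left ?_ hpos
  calc k * (k - 1).factorial * m ^ (N - k) * (k * #E)
      = k * (#E * k.factorial * m ^ (N - k)) := by rw [hfac]; ring
    _ ≤ k * (Nat.card {u : Fin k ↪ V // univ.image u ∈ E} * m ^ (N - k)) := by gcongr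
    _ ≤ _ := hsum
    _ = _ := by ring

end TightPath

/-- the Füredi–Jiang–Kostochka–Mubayi–Verstraëte bound on the Turán
number of the `k`-uniform tight path `P_r^k` of length `r`: every `n`-vertex
`k`-graph containing no tight path with `r` edges has at most
`((r−1)/2)·C(n,k−1)` edges if `k` is even, and at most
`((r + ⌊(r−1)/k⌋)/2)·C(n,k−1)` edges if `k` is odd. -/
theorem turan_tight_path (k r n : ℕ) (hk : 2 ≤ k) (hr : 1 ≤ r)
    (V : Type*) [Fintype V] [DecidableEq V] (hn : Fintype.card V = n)
    (E : Finset (Finset V)) (hE : ∀ e ∈ E, e.card = k)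
    (hno : ¬ ∃ v : ℕ → V, Set.InjOn v (Set.Iio (k + r - 1)) ∧
      ∀ i < r, ((Finset.range k).image (fun j => v (i + j))) ∈ E) :
    (E.card : ℝ) ≤
      if Even k then ((r : ℝ) - 1) / 2 * (n.choose (k - 1))
      else ((r : ℝ) + ((r - 1) / k : ℕ)) / 2 * (n.choose (k - 1)) := by
  have hmain := TightPath.mul_card_le (by omega) hr E hE hno
  rw [hn] at hmain
  obtain ⟨s, rfl⟩ : ∃ s, r = s + 1 := ⟨r - 1, by omega⟩
  simp only [Nat.add_sub_cancel] at hmain ⊢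
  have hk0 : (0 : ℝ) < k := by exact_mod_cast (by omega : 0 < k)
  refine le_of_mul_le_mul_left ?_ hk0
  split_ifs with hpar
  · have h2 : 2 * ((k + 1) / 2) = k := by
      obtain ⟨m, rfl⟩ := hpar
      omega
    have h : 2 * (k * E.card) ≤ s * k * n.choose (k - 1) := by
      calc 2 * (k * E.card) ≤ 2 * (s * ((k + 1) / 2) * n.choose (k - 1)) := by gcongr
        _ = s * (2 * ((k + 1) / 2)) * n.choose (k - 1) := by ring
        _ = _ := by rw [h2]
    have h' : (2 : ℝ) * (k * E.card) ≤ s * k * n.choose (k - 1) := by exact_mod_cast h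
    push_cast
    linarith
  · have h2 : 2 * ((k + 1) / 2) = k + 1 := by
      obtain ⟨m, rfl⟩ := Nat.not_even_iff_odd.1 hpar
      omega
    have h3 : s * (k + 1) ≤ k * (s + 1 + s / k) := by
      have := Nat.div_add_mod s k
      have := Nat.mod_lt s (by omega : 0 < k)
      nlinarith
    have h : 2 * (k * E.card) ≤ k * (s + 1 + s / k) * n.choose (k - 1) := by
      calc 2 * (k * E.card) ≤ 2 * (s * ((k + 1) / 2) * n.choose (k - 1)) := by gcongr
        _ = s * (2 * ((k + 1) / 2)) * n.choose (k - 1) := by ring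
        _ ≤ _ := by rw [h2]; gcongr
    have h' : (2 : ℝ) * (k * E.card) ≤ k * (s + 1 + (s / k : ℕ)) * n.choose (k - 1) := by
      exact_mod_cast h
    push_cast at h' ⊢
    linarith
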